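/- arXiv:math/0701682 — 2 statements merged into one kernel-verified Lean document; each statement's English description precedes it below -/
import Mathlib

section
/- Let γ > 0 and let u be the free pluriharmonic function with scalar coefficients a = (a_α)_{α∈𝔽ₙ⁺}, b = (b_α)_{|α|≥1} on the ball of radius γ, and assume u is positive. Then for every r with 0 < r < γ, every complex Hilbert space K, and every X ∈ [B(K)ⁿ]_r⁻, one has ‖u_K(X)‖ ≤ |a_{g₀}| · (γ + r)/(γ − r). -/
open scoped ENNReal ComplexOrder
open Filter ContinuousLinearMap

noncomputable section

abbrev Word (n : ℕ) := FreeMonoid (Fin n)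

/-- The word determined by a tuple of letters. -/
def word {n k : ℕ} (f : Fin k → Fin n) : Word n :=
  FreeMonoid.ofList (List.ofFn f)

/-- The length of a word. -/
def wordLen {n : ℕ} (α : Word n) : ℕ := (FreeMonoid.toList α).length

/-- The product `X_α = X_{i₁} ⋯ X_{i_k}` for `α = g_{i₁} ⋯ g_{i_k}`. -/
def wordProd {n : ℕ} {K : Type} [NormedAddCommGroup K] [InnerProductSpace ℂ K]
    (X : Fin n → K →L[ℂ] K) (α : Word n) : K →L[ℂ] K :=
  ((FreeMonoid.toList α).map X).prod

/-- `Σ_{|α| = k} a_α X_α`. -/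
def truncSum {n : ℕ} {K : Type} [NormedAddCommGroup K] [InnerProductSpace ℂ K]
    (a : Word n → ℂ) (X : Fin n → K →L[ℂ] K) (k : ℕ) : K →L[ℂ] K :=
  ∑ f : Fin k → Fin n, a (word f) • wordProd X (word f)

/-- `Σ_{|α| = k} b_α X_α*`. -/
def truncSumAdj {n : ℕ} {K : Type} [NormedAddCommGroup K] [InnerProductSpace ℂ K]
    [CompleteSpace K] (b : Word n → ℂ) (X : Fin n → K →L[ℂ] K) (k : ℕ) : K →L[ℂ] K :=
  ∑ f : Fin k → Fin n, b (word f) • adjoint (wordProd X (word f))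

/-- The free holomorphic function `f(X) = Σ_k Σ_{|α| = k} a_α X_α`. -/
def holOp {n : ℕ} {K : Type} [NormedAddCommGroup K] [InnerProductSpace ℂ K]
    (a : Word n → ℂ) (X : Fin n → K →L[ℂ] K) : K →L[ℂ] K :=
  ∑' k : ℕ, truncSum a X k

/-- The free pluriharmonic function
`u(X) = Σ_{k ≥ 1} Σ_{|α| = k} b_α X_α* + a_{g₀} I + Σ_{k ≥ 1} Σ_{|α| = k} a_α X_α`. -/
def phOp {n : ℕ} {K : Type} [NormedAddCommGroup K] [InnerProductSpace ℂ K]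
    [CompleteSpace K] (a b : Word n → ℂ) (X : Fin n → K →L[ℂ] K) : K →L[ℂ] K :=
  (∑' k : ℕ, truncSumAdj b X (k + 1)) + a 1 • (1 : K →L[ℂ] K)
    + ∑' k : ℕ, truncSum a X (k + 1)

/-- Membership in the open noncommutative ball of radius `γ`. -/
def inBall {n : ℕ} {K : Type} [NormedAddCommGroup K] [InnerProductSpace ℂ K]
    [CompleteSpace K] (γ : ℝ) (X : Fin n → K →L[ℂ] K) : Prop :=
  ‖∑ i, X i * adjoint (X i)‖ < γ ^ 2

/-- Membership in the closed noncommutative ball of radius `γ`. -/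
def inClosedBall {n : ℕ} {K : Type} [NormedAddCommGroup K] [InnerProductSpace ℂ K]
    [CompleteSpace K] (γ : ℝ) (X : Fin n → K →L[ℂ] K) : Prop :=
  ‖∑ i, X i * adjoint (X i)‖ ≤ γ ^ 2

/-- The radius-`γ` condition `limsup_k (Σ_{|α|=k} |a_α|²)^{1/(2k)} ≤ 1/γ`. -/
def radCond {n : ℕ} (γ : ℝ) (a : Word n → ℂ) : Prop :=
  Filter.limsup
    (fun k : ℕ =>
      (∑ f : Fin k → Fin n, (‖a (word f)‖₊ : ℝ≥0∞) ^ 2) ^ ((1 : ℝ) / (2 * (k : ℝ))))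
    Filter.atTop ≤ ENNReal.ofReal (1 / γ)

/-- The coefficients of the radial function: `α ↦ r^{|α|} a_α`. -/
def scaleCoef {n : ℕ} (r : ℝ) (a : Word n → ℂ) : Word n → ℂ :=
  fun α => ((r : ℂ) ^ wordLen α) * a α

/-- Positivity of the free pluriharmonic function with coefficients `(a, b)` on the
noncommutative ball of radius `γ` of every complex Hilbert space. -/
def posPH {n : ℕ} (γ : ℝ) (a b : Word n → ℂ) : Prop :=
  ∀ (K : Type) [NormedAddCommGroup K] [InnerProductSpace ℂ K] [CompleteSpace K],
    ∀ X : Fin n → K →L[ℂ] K, inBall γ X → (phOp a b X).IsPositive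


/-! Helper lemmas -/

lemma aux_scalar (R : ℝ) (hR : 1 < R) (d : ℕ → ℂ) (c : ℝ)
    (hs : ∀ s : ℝ, 0 ≤ s → s < R → Summable (fun k => ‖d k‖ * s ^ (k + 1)))
    (hp : ∀ z : ℂ, ‖z‖ < R → 0 ≤ c + (∑' k, d k * z ^ (k + 1)).re) :
    c + (∑' k, d k).re ≤ c * ((R + 1) / (R - 1)) := by
  have hc : 0 ≤ c := by
    have := hp 0 (by simp; linarith)
    simpa using this
  set F : ℂ → ℂ := fun z => -∑' k, d k * z ^ (k + 1) with hF
  have hd : DifferentiableOn ℂ F (Metric.ball 0 R) := by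
    intro z hz
    have hz' : ‖z‖ < R := by simpa using hz
    obtain ⟨s, h1, h2⟩ := exists_between hz'
    have h0 : 0 ≤ s := (norm_nonneg z).trans h1.le
    have h3 : DifferentiableOn ℂ (fun z => ∑' k, d k * z ^ (k + 1)) (Metric.ball 0 s) := by
      refine Complex.differentiableOn_tsum_of_summable_norm (hs s h0 h2) ?_ Metric.isOpen_ball ?_
      · intro k
        fun_prop
      · intro k w hw
        have hw' : ‖w‖ < s := by simpa using hw
        rw [norm_mul, norm_pow]
        gcongr
    have h4 := h3.differentiableAt (Metric.isOpen_ball.mem_nhds (show z ∈ Metric.ball 0 s by simpa using h1))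
    exact h4.neg.differentiableWithinAt
  have key : ∀ M : ℝ, c < M → c + (∑' k, d k).re ≤ c + 2 * M * 1 / (R - 1) := by
    intro M hM
    have h := Complex.borelCaratheodory_zero (M := M) (f := F) (R := R) (z := 1) (by linarith) hd
      (by
        intro z hz
        have := hp z (by simpa using hz)
        simp only [hF, Set.mem_setOf_eq, Complex.neg_re]
        linarith) (by linarith) (by simpa using hR) (by simp [hF])
    have h2 : (∑' k, d k).re ≤ ‖F 1‖ := by
      simp only [hF, one_pow, mul_one, norm_neg]
      exact Complex.re_le_norm _
    rw [norm_one] at h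
    linarith
  have h5 : Tendsto (fun M : ℝ => c + 2 * M * 1 / (R - 1)) (nhdsWithin c (Set.Ioi c))
      (nhds (c + 2 * c * 1 / (R - 1))) := by
    apply Tendsto.mono_left _ nhdsWithin_le_nhds
    apply Continuous.tendsto
    fun_prop
  have h6 := ge_of_tendsto h5 (by filter_upwards [self_mem_nhdsWithin] with M hM using key M hM)
  have h7 : c * ((R + 1) / (R - 1)) = c + 2 * c * 1 / (R - 1) := by
    have : R - 1 ≠ 0 := by linarith
    field_simp
    ring
  rw [h7]; exact h6

section aux
variable {n : ℕ} {K : Type} [NormedAddCommGroup K] [InnerProductSpace ℂ K]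

lemma wordProd_cons {k : ℕ} (X : Fin n → K →L[ℂ] K) (i : Fin n) (f : Fin k → Fin n) :
    wordProd X (word (Fin.cons i f : Fin (k+1) → Fin n)) = X i * wordProd X (word f) := by
  simp [wordProd, word, List.ofFn_succ]

lemma wordProd_smul {k : ℕ} (X : Fin n → K →L[ℂ] K) (z : ℂ) (f : Fin k → Fin n) :
    wordProd (fun i => z • X i) (word f) = z ^ k • wordProd X (word f) := by
  induction k with
  | zero => simp [wordProd, word]
  | succ k ih =>
    rw [← Fin.cons_self_tail f, wordProd_cons, wordProd_cons, ih, smul_mul_smul_comm, pow_succ']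

lemma truncSum_smul (a : Word n → ℂ) (X : Fin n → K →L[ℂ] K) (z : ℂ) (k : ℕ) :
    truncSum a (fun i => z • X i) k = z ^ k • truncSum a X k := by
  simp only [truncSum, wordProd_smul, Finset.smul_sum]
  exact Finset.sum_congr rfl fun f _ => smul_comm _ _ _

variable [CompleteSpace K]

lemma truncSumAdj_eq (b : Word n → ℂ) (X : Fin n → K →L[ℂ] K) (k : ℕ) :
    truncSumAdj b X k = adjoint (truncSum (fun w => star (b w)) X k) := by
  simp [truncSum, truncSumAdj, map_sum, map_smulₛₗ]

lemma aux_row (ρ : ℝ) (X : Fin n → K →L[ℂ] K) (hX : inClosedBall ρ X) (y : K) :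
    ∑ i, ‖adjoint (X i) y‖ ^ 2 ≤ ρ ^ 2 * ‖y‖ ^ 2 := by
  have h1 : ((∑ i, ‖adjoint (X i) y‖ ^ 2 : ℝ) : ℂ)
      = inner ℂ y ((∑ i, X i * adjoint (X i)) y) := by
    simp only [ContinuousLinearMap.sum_apply, inner_sum]
    push_cast
    refine Finset.sum_congr rfl fun i _ => ?_
    change _ = inner ℂ y ((X i) (adjoint (X i) y))
    rw [← ContinuousLinearMap.adjoint_inner_left, inner_self_eq_norm_sq_to_K]
    simp
  have h2 : ‖((∑ i, ‖adjoint (X i) y‖ ^ 2 : ℝ) : ℂ)‖ ≤ ρ ^ 2 * ‖y‖ ^ 2 := by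
    rw [h1]
    calc _ ≤ ‖y‖ * ‖(∑ i, X i * adjoint (X i)) y‖ := norm_inner_le_norm _ _
      _ ≤ ‖y‖ * (ρ ^ 2 * ‖y‖) := by
        gcongr
        exact ContinuousLinearMap.le_of_opNorm_le _ hX y
      _ = _ := by ring
  rw [Complex.norm_real] at h2
  exact (Real.le_norm_self _).trans h2

lemma aux_rows (ρ : ℝ) (X : Fin n → K →L[ℂ] K) (hX : inClosedBall ρ X) (k : ℕ) (y : K) :
    ∑ f : Fin k → Fin n, ‖adjoint (wordProd X (word f)) y‖ ^ 2 ≤ (ρ ^ k) ^ 2 * ‖y‖ ^ 2 := by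
  induction k generalizing y with
  | zero => simp [wordProd, word, ← ContinuousLinearMap.star_eq_adjoint]
  | succ k ih =>
    rw [← (Fin.consEquiv (fun _ : Fin (k+1) => Fin n)).sum_comp, Fintype.sum_prod_type]
    calc _ = ∑ i, ∑ f : Fin k → Fin n, ‖adjoint (wordProd X (word f)) (adjoint (X i) y)‖ ^ 2 := by
          refine Finset.sum_congr rfl fun i _ => Finset.sum_congr rfl fun f _ => ?_
          change ‖adjoint (wordProd X (word (Fin.cons i f : Fin (k+1) → Fin n))) y‖ ^ 2 = _
          rw [wordProd_cons, ← ContinuousLinearMap.star_eq_adjoint, star_mul]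
          rfl
      _ ≤ ∑ i, (ρ ^ k) ^ 2 * ‖adjoint (X i) y‖ ^ 2 := Finset.sum_le_sum fun i _ => ih _
      _ = (ρ ^ k) ^ 2 * ∑ i, ‖adjoint (X i) y‖ ^ 2 := by rw [Finset.mul_sum]
      _ ≤ (ρ ^ k) ^ 2 * (ρ ^ 2 * ‖y‖ ^ 2) := by gcongr; exact aux_row ρ X hX y
      _ = _ := by ring

lemma aux_norm (ρ : ℝ) (hρ : 0 ≤ ρ) (X : Fin n → K →L[ℂ] K) (hX : inClosedBall ρ X)
    (a : Word n → ℂ) (k : ℕ) :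
    ‖truncSum a X k‖ ≤ √(∑ f : Fin k → Fin n, ‖a (word f)‖ ^ 2) * ρ ^ k := by
  rw [← LinearIsometryEquiv.norm_map ContinuousLinearMap.adjoint]
  refine ContinuousLinearMap.opNorm_le_bound _ (by positivity) fun y => ?_
  have : adjoint (truncSum a X k) y
      = ∑ f : Fin k → Fin n, star (a (word f)) • adjoint (wordProd X (word f)) y := by
    simp [truncSum, map_sum, map_smulₛₗ]
  rw [this]
  calc _ ≤ ∑ f : Fin k → Fin n, ‖a (word f)‖ * ‖adjoint (wordProd X (word f)) y‖ := by
        refine (norm_sum_le _ _).trans_eq (Finset.sum_congr rfl fun f _ => ?_)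
        rw [norm_smul, norm_star]
    _ ≤ √(∑ f : Fin k → Fin n, ‖a (word f)‖ ^ 2) *
        √(∑ f : Fin k → Fin n, ‖adjoint (wordProd X (word f)) y‖ ^ 2) :=
        Real.sum_mul_le_sqrt_mul_sqrt _ _ _
    _ ≤ √(∑ f : Fin k → Fin n, ‖a (word f)‖ ^ 2) * √((ρ ^ k * ‖y‖) ^ 2) := by
        gcongr
        rw [mul_pow]
        exact aux_rows ρ X hX k y
    _ = _ := by rw [Real.sqrt_sq (by positivity)]; ring

end aux

lemma aux_summable {n : ℕ} (γ ρ : ℝ) (hρ : 0 ≤ ρ) (hργ : ρ < γ) (a : Word n → ℂ)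
    (ha : radCond γ a) :
    Summable fun k : ℕ => √(∑ f : Fin k → Fin n, ‖a (word f)‖ ^ 2) * ρ ^ k := by
  obtain ⟨t, h1, h2⟩ := exists_between hργ
  have ht : 0 < t := hρ.trans_lt h1
  have hlt : ENNReal.ofReal (1 / γ) < ENNReal.ofReal (1 / t) := by
    rw [ENNReal.ofReal_lt_ofReal_iff (by positivity)]
    exact one_div_lt_one_div_of_lt ht h2
  have hev := eventually_lt_of_limsup_lt (lt_of_le_of_lt ha hlt)
  have hg : Summable fun k : ℕ => (ρ / t) ^ k :=
    summable_geometric_of_lt_one (by positivity) ((div_lt_one ht).2 h1)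
  refine summable_of_isBigO_nat hg ?_
  refine Asymptotics.IsBigO.of_bound 1 ?_
  filter_upwards [hev, eventually_gt_atTop 0] with k hk hk0
  have hk0' : (0 : ℝ) < k := by exact_mod_cast hk0
  have e1 : (∑ f : Fin k → Fin n, (‖a (word f)‖₊ : ℝ≥0∞) ^ 2)
      = ENNReal.ofReal (∑ f : Fin k → Fin n, ‖a (word f)‖ ^ 2) := by
    rw [ENNReal.ofReal_sum_of_nonneg (fun _ _ => by positivity)]
    refine Finset.sum_congr rfl fun f _ => ?_
    rw [ENNReal.ofReal_pow (norm_nonneg _), ofReal_norm_eq_enorm]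
    rfl
  set S := ∑ f : Fin k → Fin n, ‖a (word f)‖ ^ 2 with hS
  have hS0 : 0 ≤ S := Finset.sum_nonneg fun _ _ => by positivity
  rw [e1, ENNReal.ofReal_rpow_of_nonneg hS0 (by positivity),
    ENNReal.ofReal_lt_ofReal_iff (by positivity)] at hk
  have e2 : √S ≤ (1 / t) ^ k := by
    have : √S = (S ^ ((1 : ℝ) / (2 * k))) ^ k := by
      rw [← Real.rpow_natCast, ← Real.rpow_mul hS0, Real.sqrt_eq_rpow]
      congr 1
      field_simp
    rw [this]
    gcongr
  rw [one_mul, Real.norm_of_nonneg (by positivity), Real.norm_of_nonneg (by positivity)]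
  calc √S * ρ ^ k ≤ (1 / t) ^ k * ρ ^ k := by gcongr
    _ = (ρ / t) ^ k := by rw [← mul_pow]; congr 1; ring

section aux2
variable {n : ℕ} {K : Type} [NormedAddCommGroup K] [InnerProductSpace ℂ K] [CompleteSpace K]

lemma aux_ball (r : ℝ) (X : Fin n → K →L[ℂ] K) (hX : inClosedBall r X) (z : ℂ) :
    ‖∑ i, (z • X i) * adjoint (z • X i)‖ ≤ (‖z‖ * r) ^ 2 := by
  have : ∑ i, (z • X i) * adjoint (z • X i) = (z * star z) • ∑ i, X i * adjoint (X i) := by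
    rw [Finset.smul_sum]
    refine Finset.sum_congr rfl fun i _ => ?_
    rw [map_smulₛₗ, smul_mul_smul_comm]
    rfl
  rw [this, norm_smul, norm_mul, norm_star, mul_pow, ← sq]
  gcongr
  exact hX

lemma radCond_star (γ : ℝ) (b : Word n → ℂ) (hb : radCond γ b) :
    radCond γ (fun w => star (b w)) := by
  simpa [radCond] using hb

lemma aux_re (γ ρ : ℝ) (hρ : 0 ≤ ρ) (hργ : ρ < γ) (a b : Word n → ℂ)
    (ha : radCond γ a) (hb : radCond γ b) (X : Fin n → K →L[ℂ] K) (hX : inClosedBall ρ X) (x : K) :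
    Summable (fun k => ‖inner ℂ x (truncSum a X (k + 1) x)
        + inner ℂ x (truncSum (fun w => star (b w)) X (k + 1) x)‖) ∧
    (inner ℂ x (phOp a b X x) : ℂ).re = (a 1).re * ‖x‖ ^ 2 +
      (∑' k, (inner ℂ x (truncSum a X (k + 1) x)
        + inner ℂ x (truncSum (fun w => star (b w)) X (k + 1) x))).re := by
  have sA : ∀ a : Word n → ℂ, radCond γ a → Summable (fun k => ‖truncSum a X (k + 1)‖) := by
    intro a ha
    refine Summable.of_nonneg_of_le (fun _ => norm_nonneg _) (fun k => aux_norm ρ hρ X hX a (k+1)) ?_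
    exact (summable_nat_add_iff 1).2 (aux_summable γ ρ hρ hργ a ha)
  have hb' := radCond_star γ b hb
  let L : (K →L[ℂ] K) →L[ℂ] ℂ := (innerSL ℂ x).comp (ContinuousLinearMap.apply ℂ K x)
  have hL : ∀ T, L T = inner ℂ x (T x) := fun T => rfl
  have s1 := sA a ha
  have s2 := sA _ hb'
  have hL1 : ∀ a : Word n → ℂ, radCond γ a →
      Summable (fun k => ‖(inner ℂ x (truncSum a X (k + 1) x) : ℂ)‖) := by
    intro a ha
    refine Summable.of_nonneg_of_le (fun _ => norm_nonneg _) (fun k => ?_) ((sA a ha).mul_left ‖L‖)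
    rw [← hL]
    exact L.le_opNorm _
  have t1 := hL1 a ha
  have t2 := hL1 _ hb'
  refine ⟨Summable.of_nonneg_of_le (fun _ => norm_nonneg _) (fun k => norm_add_le _ _) (t1.add t2), ?_⟩
  have e1 : L (∑' k, truncSum a X (k + 1)) = ∑' k, inner ℂ x (truncSum a X (k + 1) x) :=
    L.map_tsum s1.of_norm
  have s3 : Summable (fun k => truncSumAdj b X (k + 1)) := by
    apply Summable.of_norm
    simpa only [truncSumAdj_eq, LinearIsometryEquiv.norm_map] using s2
  have e2 : L (∑' k, truncSumAdj b X (k + 1))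
      = star (∑' k, inner ℂ x (truncSum (fun w => star (b w)) X (k + 1) x)) := by
    rw [L.map_tsum s3, tsum_star]
    refine tsum_congr fun k => ?_
    rw [hL, truncSumAdj_eq, ContinuousLinearMap.adjoint_inner_right]
    exact (inner_conj_symm _ _).symm
  rw [← hL, phOp, map_add, map_add, e1, e2, Summable.tsum_add t1.of_norm t2.of_norm, map_smul, hL]
  simp only [Complex.add_re, smul_eq_mul, ContinuousLinearMap.one_apply,
    inner_self_eq_norm_sq_to_K]
  have : (a 1 * ((‖x‖ : ℂ)) ^ 2).re = (a 1).re * ‖x‖ ^ 2 := by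
    rw [← Complex.ofReal_pow, Complex.re_mul_ofReal]
  have h3 : ∀ w : ℂ, (star w).re = w.re := fun w => Complex.conj_re w
  rw [h3]
  simp only [Complex.coe_algebraMap]
  rw [this]
  ring

end aux2

/-- Harnack-type inequality for positive free pluriharmonic functions:
`‖u(X)‖ ≤ |a_{g₀}| (γ + r)/(γ − r)` on the closed ball of radius `r < γ`. -/
theorem stmt_4 (n : ℕ) (hn : 1 ≤ n) (γ : ℝ) (hγ : 0 < γ)
    (a b : Word n → ℂ) (ha : radCond γ a) (hb : radCond γ b)
    (hpos : posPH γ a b) :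
    ∀ r : ℝ, 0 < r → r < γ →
      ∀ (K : Type) [NormedAddCommGroup K] [InnerProductSpace ℂ K] [CompleteSpace K]
        (X : Fin n → K →L[ℂ] K), inClosedBall r X →
          ‖phOp a b X‖ ≤ ‖a 1‖ * ((γ + r) / (γ - r)) := by
  intro r hr hrγ K _ _ _ X hX
  have hp0 : (phOp a b X).IsPositive := by
    apply hpos
    refine lt_of_le_of_lt hX ?_
    gcongr
  have hC : 0 ≤ (γ + r) / (γ - r) := div_nonneg (by linarith) (by linarith)
  have main : ∀ x : K, (inner ℂ x (phOp a b X x) : ℂ).re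
      ≤ ‖a 1‖ * ((γ + r) / (γ - r)) * ‖x‖ ^ 2 := by
    intro x
    set d : ℕ → ℂ := fun k => inner ℂ x (truncSum a X (k + 1) x)
        + inner ℂ x (truncSum (fun w => star (b w)) X (k + 1) x) with hd
    have hz : ∀ z : ℂ, ‖z‖ < γ / r → Summable (fun k => ‖d k * z ^ (k + 1)‖) ∧
        0 ≤ (a 1).re * ‖x‖ ^ 2 + (∑' k, d k * z ^ (k + 1)).re := by
      intro z hz
      have h1 : ‖z‖ * r < γ := (lt_div_iff₀ hr).1 hz
      have hb1 := aux_ball r X hX z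
      have h2 := aux_re γ (‖z‖ * r) (by positivity) h1 a b ha hb (fun i => z • X i) hb1 x
      have h3 : (phOp a b (fun i => z • X i)).IsPositive := by
        apply hpos
        refine lt_of_le_of_lt hb1 ?_
        gcongr
      have h4 : 0 ≤ (inner ℂ x (phOp a b (fun i => z • X i) x) : ℂ).re :=
        h3.re_inner_nonneg_right x
      have h5 : ∀ k, (inner ℂ x (truncSum a (fun i => z • X i) (k + 1) x)
          + inner ℂ x (truncSum (fun w => star (b w)) (fun i => z • X i) (k + 1) x) : ℂ)
          = d k * z ^ (k + 1) := by
        intro k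
        simp only [hd, truncSum_smul, ContinuousLinearMap.smul_apply, inner_smul_right]
        ring
      simp only [h5] at h2
      exact ⟨h2.1, h2.2 ▸ h4⟩
    have hR : 1 < γ / r := (one_lt_div hr).2 hrγ
    have h6 := aux_scalar (γ / r) hR d ((a 1).re * ‖x‖ ^ 2) (by
      intro s hs0 hs
      have := (hz (s : ℂ) (by simpa [abs_of_nonneg hs0] using hs)).1
      simpa [abs_of_nonneg hs0] using this) (fun z h => (hz z h).2)
    have h7 := (aux_re γ r hr.le hrγ a b ha hb X hX x).2
    rw [h7]
    refine h6.trans ?_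
    have h8 : (γ / r + 1) / (γ / r - 1) = (γ + r) / (γ - r) := by
      have : γ - r ≠ 0 := by linarith
      have : γ / r - 1 ≠ 0 := by linarith
      field_simp
    rw [h8]
    have := Complex.re_le_norm (a 1)
    calc _ ≤ ‖a 1‖ * ‖x‖ ^ 2 * ((γ + r) / (γ - r)) := by gcongr
      _ = _ := by ring
  rw [CStarAlgebra.norm_le_iff_le_algebraMap (phOp a b X) (by positivity)
    ((ContinuousLinearMap.nonneg_iff_isPositive _).2 hp0)]
  rw [ContinuousLinearMap.le_def, ContinuousLinearMap.isPositive_def']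
  refine ⟨(IsSelfAdjoint.algebraMap _ (IsSelfAdjoint.all _)).sub hp0.isSelfAdjoint, fun x => ?_⟩
  have hm := main x
  rw [ContinuousLinearMap.reApplyInnerSelf_apply, inner_re_symm, ContinuousLinearMap.sub_apply,
    inner_sub_right, map_sub, sub_nonneg]
  refine hm.trans_eq ?_
  rw [Algebra.algebraMap_eq_smul_one, ContinuousLinearMap.smul_apply,
    ContinuousLinearMap.one_apply, inner_smul_right_eq_smul, inner_self_eq_norm_sq_to_K,
    RCLike.smul_re]
  norm_cast

end
end

section
/- Let γ > 0 and let u be the free pluriharmonic function with scalar coefficients (a, b) on the ball of radius γ, and assume u is self-adjoint, i.e., a_{g₀} ∈ ℝ and b_α = conj(a_α) for all |α| ≥ 1. Suppose that either (i) u_K(0) − u_K(X) is a positive operator for every complex Hilbert space K and every X ∈ [B(K)ⁿ]_γ, or (ii) u_K(X) − u_K(0) is a positive operator for every complex Hilbert space K and every X ∈ [B(K)ⁿ]_γ. Then a_α = 0 for all α with |α| ≥ 1; consequently u_K(X) = a_{g₀} I for every K and every X ∈ [B(K)ⁿ]_γ. -/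
open scoped ENNReal ComplexOrder
open Filter ContinuousLinearMap

noncomputable section

lemma aux_pos {K : Type} [NormedAddCommGroup K] [InnerProductSpace ℂ K] [CompleteSpace K]
    {T : K →L[ℂ] K} (hT : T.IsPositive) (x : K) (hx : inner ℂ (T x) x = 0) : T x = 0 := by
  set z := T x with hz
  have key : ∀ t : ℝ, 0 ≤ (inner ℂ (T z) z).re * (t * t) + (2 * ‖z‖ ^ 2) * t + 0 := by
    intro t
    have h1 := hT.re_inner_nonneg_left (x + (t : ℂ) • z)
    have h2 : inner ℂ (T z) x = inner ℂ z z := by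
      rw [hT.inner_left_eq_inner_right z x]
    rw [map_add, map_smul, inner_add_left, inner_add_right, inner_add_right, inner_smul_left,
      inner_smul_left, inner_smul_right, inner_smul_right, ← hz, h2, hx,
      inner_self_eq_norm_sq_to_K] at h1
    simp only [Complex.conj_ofReal, RCLike.re_to_complex, Complex.coe_algebraMap] at h1
    rw [← Complex.ofReal_pow] at h1
    simp only [Complex.add_re, Complex.re_ofReal_mul, Complex.zero_re, Complex.ofReal_re] at h1
    linarith
  have h3 := discrim_le_zero key
  unfold discrim at h3
  have h4 : ‖z‖ ^ 2 = 0 := by nlinarith [sq_nonneg (‖z‖ ^ 2)]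
  simpa using h4

/-- Extension by zero of a finite vector. -/
def extZ {N : ℕ} (v : EuclideanSpace ℂ (Fin N)) (m : ℕ) : ℂ :=
  if h : m < N then v ⟨m, h⟩ else 0

lemma extZ_coe {N : ℕ} (v : EuclideanSpace ℂ (Fin N)) (m : Fin N) : extZ v m = v m := by
  simp [extZ]

/-- Weighted backward shift along the word `l`. -/
def shiftY {n : ℕ} (l : List (Fin n)) (i : Fin n) :
    EuclideanSpace ℂ (Fin (l.length + 1)) →L[ℂ] EuclideanSpace ℂ (Fin (l.length + 1)) :=
  LinearMap.toContinuousLinearMap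
    { toFun := fun v => WithLp.toLp 2 (fun j => if l[(j : ℕ)]? = some i then extZ v (j + 1) else 0)
      map_add' := by
        intro v w
        ext j
        by_cases h : (j : ℕ) < l.length <;> simp [extZ, h]
        split_ifs <;> simp
      map_smul' := by
        intro c v
        ext j
        by_cases h : (j : ℕ) < l.length <;> simp [extZ, h] }

lemma extZ_shiftY {n : ℕ} (l : List (Fin n)) (i : Fin n)
    (v : EuclideanSpace ℂ (Fin (l.length + 1))) (j : ℕ) :
    extZ (shiftY l i v) j = if l[j]? = some i then extZ v (j + 1) else 0 := by
  by_cases h : j < l.length + 1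
  · simp [extZ, h, shiftY]
  · have : l[j]? = none := by simp; omega
    simp [extZ, h, this]

lemma extZ_smul {N : ℕ} (c : ℂ) (v : EuclideanSpace ℂ (Fin N)) (m : ℕ) :
    extZ (c • v) m = c * extZ v m := by
  by_cases h : m < N <;> simp [extZ, h]

lemma extZ_prod {n : ℕ} (l : List (Fin n)) (r : ℂ) (w : List (Fin n))
    (v : EuclideanSpace ℂ (Fin (l.length + 1))) (j : ℕ) :
    extZ ((w.map (fun i => r • shiftY l i)).prod v) j =
      if w <+: l.drop j then r ^ w.length * extZ v (j + w.length) else 0 := by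
  induction w generalizing j with
  | nil => simp
  | cons i w ih =>
    rw [List.map_cons, List.prod_cons, ContinuousLinearMap.mul_apply,
      ContinuousLinearMap.smul_apply, extZ_smul, extZ_shiftY, ih]
    by_cases h : j < l.length
    · simp only [List.drop_eq_getElem_cons h, List.cons_prefix_cons, List.getElem?_eq_getElem h]
      by_cases h1 : l[j] = i
      · by_cases h2 : w <+: l.drop (j + 1)
        · simp [h1, h2, pow_succ]
          rw [show j + 1 + w.length = j + (w.length + 1) by ring]; ring
        · simp [h2]
      · simp [h1, Ne.symm h1]
    · have h1 : l.drop j = [] := List.drop_eq_nil_of_le (by omega)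
      have h2 : l[j]? = none := List.getElem?_eq_none (by omega)
      rw [if_neg (by simp [h2]), if_neg (by simp [h1]), mul_zero]

lemma wordLen_word {n k : ℕ} (f : Fin k → Fin n) : wordLen (word f) = k := by
  simp [wordLen, word]

lemma truncSumAdj_eq_s6 {n : ℕ} {K : Type} [NormedAddCommGroup K] [InnerProductSpace ℂ K]
    [CompleteSpace K] (a b : Word n → ℂ)
    (hsa : ∀ α : Word n, 1 ≤ wordLen α → b α = (starRingEnd ℂ) (a α))
    (X : Fin n → K →L[ℂ] K) (k : ℕ) :
    truncSumAdj b X (k + 1) = adjoint (truncSum a X (k + 1)) := by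
  unfold truncSumAdj truncSum
  rw [map_sum]
  refine Finset.sum_congr rfl fun f _ => ?_
  rw [hsa _ (by rw [wordLen_word]; omega), map_smulₛₗ]

lemma truncSum_zero {n : ℕ} {K : Type} [NormedAddCommGroup K] [InnerProductSpace ℂ K]
    (a : Word n → ℂ) (k : ℕ) :
    truncSum a (fun _ => (0 : K →L[ℂ] K)) (k + 1) = 0 := by
  unfold truncSum
  refine Finset.sum_eq_zero fun f _ => ?_
  simp [wordProd, word]

lemma truncSum_apply {n : ℕ} (a : Word n → ℂ) (l : List (Fin n)) (r : ℂ) (k : ℕ)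
    (v : EuclideanSpace ℂ (Fin (l.length + 1))) (j : Fin (l.length + 1)) :
    truncSum a (fun i => r • shiftY l i) k v j =
      ∑ f : Fin k → Fin n, a (word f) *
        (if List.ofFn f <+: l.drop j then r ^ k * extZ v (j + k) else 0) := by
  unfold truncSum
  rw [ContinuousLinearMap.sum_apply, WithLp.ofLp_sum, Finset.sum_apply]
  refine Finset.sum_congr rfl fun f _ => ?_
  have := extZ_prod l r (List.ofFn f) v j
  rw [extZ_coe, List.length_ofFn] at this
  rw [← this]
  simp [wordProd, word]

lemma exists_small {n : ℕ} {K : Type} [NormedAddCommGroup K] [InnerProductSpace ℂ K]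
    [CompleteSpace K] (γ : ℝ) (hγ : 0 < γ) (Y : Fin n → K →L[ℂ] K) :
    ∃ r : ℝ, 0 < r ∧ inBall γ (fun i => (r : ℂ) • Y i) := by
  have hc : Continuous fun r : ℝ => ‖∑ i, ((r : ℂ) • Y i) * adjoint ((r : ℂ) • Y i)‖ := by
    refine continuous_norm.comp (continuous_finsetSum _ fun i _ => ?_)
    have h1 : Continuous fun r : ℝ => (r : ℂ) • Y i :=
      Complex.continuous_ofReal.smul continuous_const
    exact h1.mul ((LinearIsometryEquiv.continuous _).comp h1)
  have h0 := hc.tendsto 0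
  have hz : ‖∑ i, (((0 : ℝ) : ℂ) • Y i) * adjoint (((0 : ℝ) : ℂ) • Y i)‖ = 0 := by
    simp
  rw [hz] at h0
  have h1 := (h0.eventually (gt_mem_nhds (show (0 : ℝ) < γ ^ 2 by positivity)))
  have h2 : ∀ᶠ r : ℝ in nhdsWithin 0 (Set.Ioi 0), 0 < r ∧
      ‖∑ i, ((r : ℂ) • Y i) * adjoint ((r : ℂ) • Y i)‖ < γ ^ 2 :=
    (eventually_mem_nhdsWithin).and (h1.filter_mono nhdsWithin_le_nhds)
  exact h2.exists

lemma coef_zero {n : ℕ} (γ : ℝ) (hγ : 0 < γ) (a b : Word n → ℂ)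
    (hsa : ∀ α : Word n, 1 ≤ wordLen α → b α = (starRingEnd ℂ) (a α))
    (h :
      (∀ (K : Type) [NormedAddCommGroup K] [InnerProductSpace ℂ K] [CompleteSpace K]
        (X : Fin n → K →L[ℂ] K), inBall γ X →
          (phOp a b (fun _ => (0 : K →L[ℂ] K)) - phOp a b X).IsPositive) ∨
      (∀ (K : Type) [NormedAddCommGroup K] [InnerProductSpace ℂ K] [CompleteSpace K]
        (X : Fin n → K →L[ℂ] K), inBall γ X →
          (phOp a b X - phOp a b (fun _ => (0 : K →L[ℂ] K))).IsPositive))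
    (l : List (Fin n)) (p : ℕ) (hp : l.length = p + 1) : a (FreeMonoid.ofList l) = 0 := by
  obtain ⟨r, hr0, hr⟩ := exists_small γ hγ (shiftY l)
  set X := (fun i => (r : ℂ) • shiftY l i) with hX
  set A := ∑' k : ℕ, truncSum a X (k + 1) with hA
  have hA' : A = ∑ k ∈ Finset.range (p + 1), truncSum a X (k + 1) := by
    refine tsum_eq_sum fun k hk => ?_
    ext v j
    rw [truncSum_apply]
    refine Finset.sum_eq_zero fun f _ => ?_
    rw [if_neg, mul_zero]
    intro hpre
    have := hpre.length_le
    simp at this hk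
    omega
  have hadj : ∑' k : ℕ, truncSumAdj b X (k + 1) = adjoint A := by
    rw [hA]
    simp_rw [truncSumAdj_eq_s6 a b hsa]
    exact ((adjoint (𝕜 := ℂ)).toContinuousLinearEquiv.map_tsum).symm
  have hdiff : phOp a b X - phOp a b (fun _ => (0 : EuclideanSpace ℂ (Fin (l.length + 1)) →L[ℂ] EuclideanSpace ℂ (Fin (l.length + 1)))) = adjoint A + A := by
    unfold phOp
    simp_rw [hadj, truncSumAdj_eq_s6 a b hsa, truncSum_zero, ← hA]
    simp
    abel
  set e0 : EuclideanSpace ℂ (Fin (l.length + 1)) := EuclideanSpace.single 0 1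
  set ek : EuclideanSpace ℂ (Fin (l.length + 1)) := EuclideanSpace.single (Fin.last _) 1
  have hAe0 : A e0 = 0 := by
    rw [hA', ContinuousLinearMap.sum_apply]
    refine Finset.sum_eq_zero fun k _ => ?_
    ext j
    rw [truncSum_apply]
    refine Finset.sum_eq_zero fun f _ => ?_
    have : extZ e0 (j + (k + 1)) = 0 := by
      unfold extZ
      split_ifs with hh
      · rw [EuclideanSpace.single_apply, if_neg]
        intro hc
        have := congrArg Fin.val hc
        simp at this
      · rfl
    rw [this, mul_zero, ite_self, mul_zero]
  have hin : inner ℂ ((adjoint A + A) e0) e0 = 0 := by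
    rw [ContinuousLinearMap.add_apply, hAe0, add_zero, adjoint_inner_left, hAe0, inner_zero_right]
  have hT : (adjoint A + A) e0 = 0 := by
    rcases h with h | h
    · have h1 := h _ X hr
      rw [← neg_sub, hdiff] at h1
      have := aux_pos h1 e0 (by rw [ContinuousLinearMap.neg_apply, inner_neg_left, hin, neg_zero])
      simpa only [ContinuousLinearMap.neg_apply, neg_eq_zero] using this
    · have h1 := h _ X hr
      rw [hdiff] at h1
      exact aux_pos h1 e0 hin
  rw [ContinuousLinearMap.add_apply, hAe0, add_zero] at hT
  have hz : inner ℂ e0 (A ek) = 0 := by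
    rw [← adjoint_inner_left, hT, inner_zero_left]
  have hz' : A ek 0 = 0 := by
    simpa [e0, EuclideanSpace.inner_single_left] using hz
  rw [hA', ContinuousLinearMap.sum_apply, WithLp.ofLp_sum, Finset.sum_apply,
    Finset.sum_eq_single p] at hz'
  · rw [truncSum_apply, Finset.sum_eq_single (fun i : Fin (p + 1) => l[(i : ℕ)])] at hz'
    · have hl : List.ofFn (fun i : Fin (p + 1) => l[(i : ℕ)]) = l := by
        apply List.ext_getElem <;> simp [hp, -List.ofFn_succ]
      have he : extZ ek (p + 1) = 1 := by
        simp [extZ, ek, hp, Fin.ext_iff]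
      simp only [word, hl] at hz'
      simpa [he, hr0.ne'] using hz'
    · intro f _ hf
      rw [if_neg, mul_zero]
      intro hpre
      apply hf
      have := hpre.eq_of_length (by simp [hp])
      simp only [Fin.val_zero, List.drop_zero] at this
      ext i
      simp [← this, -List.ofFn_succ]
    · simp
  · intro k _ hk
    rw [truncSum_apply]
    refine Finset.sum_eq_zero fun f _ => ?_
    have : extZ ek ((0 : Fin (l.length + 1)) + (k + 1)) = 0 := by
      unfold extZ
      split_ifs with hh
      · rw [EuclideanSpace.single_apply, if_neg]
        intro hc
        have := congrArg Fin.val hc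
        simp at this
        omega
      · rfl
    rw [this, mul_zero, ite_self, mul_zero]
  · simp

/-- Maximum/minimum principle for self-adjoint free pluriharmonic
functions: if `u ≤ u(0)` everywhere, or `u ≥ u(0)` everywhere, then `u` is constant. -/
theorem stmt_6 (n : ℕ) (hn : 1 ≤ n) (γ : ℝ) (hγ : 0 < γ)
    (a b : Word n → ℂ) (ha : radCond γ a) (hb : radCond γ b)
    (hre : (a 1).im = 0)
    (hsa : ∀ α : Word n, 1 ≤ wordLen α → b α = (starRingEnd ℂ) (a α))
    (h :
      (∀ (K : Type) [NormedAddCommGroup K] [InnerProductSpace ℂ K] [CompleteSpace K]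
        (X : Fin n → K →L[ℂ] K), inBall γ X →
          (phOp a b (fun _ => (0 : K →L[ℂ] K)) - phOp a b X).IsPositive) ∨
      (∀ (K : Type) [NormedAddCommGroup K] [InnerProductSpace ℂ K] [CompleteSpace K]
        (X : Fin n → K →L[ℂ] K), inBall γ X →
          (phOp a b X - phOp a b (fun _ => (0 : K →L[ℂ] K))).IsPositive)) :
    (∀ α : Word n, 1 ≤ wordLen α → a α = 0) ∧
      (∀ (K : Type) [NormedAddCommGroup K] [InnerProductSpace ℂ K] [CompleteSpace K]
        (X : Fin n → K →L[ℂ] K), inBall γ X →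
          phOp a b X = a 1 • (1 : K →L[ℂ] K)) := by
  have hcoef : ∀ α : Word n, 1 ≤ wordLen α → a α = 0 := fun α hα =>
    coef_zero γ hγ a b hsa h (FreeMonoid.toList α) (wordLen α - 1)
      (by change wordLen α = _; omega)
  refine ⟨hcoef, fun K _ _ _ X _ => ?_⟩
  have h0 : ∀ k, truncSum a X (k + 1) = 0 := fun k =>
    Finset.sum_eq_zero fun f _ => by
      rw [hcoef _ (by rw [wordLen_word]; omega), zero_smul]
  unfold phOp
  simp_rw [truncSumAdj_eq_s6 a b hsa, h0]
  simp

end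
end
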